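/- arXiv:2310.00090 — 3 statements merged into one kernel-verified Lean document; each statement's English description precedes it below -/
import Mathlib

section
/- Let r ≥ 3 and let 𝔽 = 𝔽_{2^r}. The number of tuples (a,b,c,d) ∈ 𝔽^4 such that the 4×4 Hadamard matrix Had(a,b,c,d) is MDS and not involutory (equivalently, Had(a,b,c,d) is MDS and a + b + c + d ≠ 1) equals (2^r−2)²(2^r−4)(2^r−7). -/
open Matrix

/-- A square matrix is MDS if every square submatrix (selected via injective
row and column index maps) is nonsingular. -/
def IsMDS {F : Type*} [Field F] {ι : Type*} (M : Matrix ι ι F) : Prop :=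
  ∀ (k : ℕ) (row : Fin k → ι) (col : Fin k → ι),
    Function.Injective row → Function.Injective col →
    (M.submatrix row col).det ≠ 0

/-- The `4 × 4` finite-field Hadamard matrix with first row `a, b, c, d`. -/
def Had {F : Type*} (a b c d : F) : Matrix (Fin 4) (Fin 4) F :=
  !![a, b, c, d; b, a, d, c; c, d, a, b; d, c, b, a]

namespace Matrix

/-- Reordering rows and columns by injective self-maps preserves nonsingularity. -/
theorem det_submatrix_ne_zero_of_injective {F n : Type*} [Field F] [Fintype n] [DecidableEq n]
    {A : Matrix n n F} (hA : A.det ≠ 0) {f g : n → n} (hf : Function.Injective f)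
    (hg : Function.Injective g) : (A.submatrix f g).det ≠ 0 := by
  let σ := Equiv.ofBijective f (Finite.injective_iff_bijective.mp hf)
  let τ := Equiv.ofBijective g (Finite.injective_iff_bijective.mp hg)
  have h : A.submatrix f g = (A.submatrix σ id).submatrix id τ := rfl
  rw [h, det_permute', det_permute]
  have hs (π : Equiv.Perm n) : ((Equiv.Perm.sign π : ℤ) : F) ≠ 0 := by
    rcases Int.units_eq_one_or (Equiv.Perm.sign π) with h | h <;> simp [h]
  exact mul_ne_zero (hs τ) (mul_ne_zero (hs σ) hA)

end Matrix

/-- An injective map `Fin n → Fin (n + 1)` is a `succAbove` precomposed with an injection. -/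
theorem Fin.exists_eq_succAbove_comp {n : ℕ} {f : Fin n → Fin (n + 1)}
    (hf : Function.Injective f) :
    ∃ (i : Fin (n + 1)) (e : Fin n → Fin n), Function.Injective e ∧ f = i.succAbove ∘ e := by
  have hns : ¬ Function.Surjective f := fun hs => by
    simpa using Fintype.card_le_of_surjective f hs
  obtain ⟨i, hi⟩ := not_forall.mp hns
  choose e he using fun x => Fin.exists_succAbove_eq (x := f x) (y := i) fun h => hi ⟨x, h⟩
  refine ⟨i, e, fun x y hxy => hf ?_, funext fun x => (he x).symm⟩
  rw [← he x, ← he y, hxy]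

section Hadamard

variable {F : Type*} [Field F]

/-- The polynomial conditions on the first row for a Hadamard matrix to be MDS. -/
def HadCond (a b c d : F) : Prop :=
  a ≠ 0 ∧ b ≠ 0 ∧ c ≠ 0 ∧ d ≠ 0 ∧ a ≠ b ∧ a ≠ c ∧ a ≠ d ∧ b ≠ c ∧ b ≠ d ∧ c ≠ d ∧
    a * b ≠ c * d ∧ a * c ≠ b * d ∧ a * d ≠ b * c ∧ a + b + c + d ≠ 0

theorem HadCond.apply_ne_zero {a b c d : F} (h : HadCond a b c d) (i j : Fin 4) :
    Had a b c d i j ≠ 0 := by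
  obtain ⟨ha, hb, hc, hd, -⟩ := h
  fin_cases i <;> fin_cases j <;> simpa [Had]

theorem HadCond.smul_iff {x : F} (hx : x ≠ 0) (a b c d : F) :
    HadCond (x * a) (x * b) (x * c) (x * d) ↔ HadCond a b c d := by
  have h1 (p q r s : F) : x * p * (x * q) = x * r * (x * s) ↔ p * q = r * s := by
    rw [mul_mul_mul_comm, mul_mul_mul_comm x r, mul_right_inj' (mul_ne_zero hx hx)]
  simp only [HadCond, ne_eq, h1, ← mul_add, mul_eq_zero, hx, false_or, mul_right_inj' hx]

variable [CharP F 2]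

theorem Had_mul_self (a b c d : F) :
    Had a b c d * Had a b c d = (a + b + c + d) ^ 2 • (1 : Matrix (Fin 4) (Fin 4) F) := by
  have h2 : (2 : F) = 0 := CharTwo.two_eq_zero
  ext i j
  fin_cases i <;> fin_cases j <;> simp [Had, Matrix.mul_apply, Fin.sum_univ_four] <;> grind

theorem Had_mul_self_eq_one_iff (a b c d : F) :
    Had a b c d * Had a b c d = 1 ↔ a + b + c + d = 1 := by
  rw [Had_mul_self]
  constructor
  · intro h
    have h00 := congrFun (congrFun h 0) 0
    simp only [Matrix.smul_apply, Matrix.one_apply_eq, smul_eq_mul, mul_one] at h00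
    exact CharTwo.sq_injective (by simpa using h00)
  · intro h
    simp [h]

theorem Had_det_ne_zero {a b c d : F} (h : a + b + c + d ≠ 0) : (Had a b c d).det ≠ 0 := by
  intro h0
  have h1 := congrArg Matrix.det (Had_mul_self a b c d)
  rw [Matrix.det_mul, h0, Matrix.det_smul] at h1
  exact h (by simpa using h1.symm)

theorem HadCond.minor_two_ne_zero {a b c d : F} (h : HadCond a b c d) {i i' j j' : Fin 4}
    (hi : i ≠ i') (hj : j ≠ j') :
    Had a b c d i j * Had a b c d i' j' - Had a b c d i j' * Had a b c d i' j ≠ 0 := by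
  obtain ⟨ha, hb, hc, hd, hab, hac, had, hbc, hbd, hcd, h1, h2, h3, hs⟩ := h
  have hsq {x y : F} (hxy : x ≠ y) : x * x ≠ y * y := fun h =>
    hxy (CharTwo.sq_injective (by simpa [sq] using h))
  have := hsq hab
  have := hsq hac
  have := hsq had
  have := hsq hbc
  have := hsq hbd
  have := hsq hcd
  clear hsq
  rw [sub_ne_zero]
  fin_cases i <;> fin_cases i' <;> first | exact absurd rfl hi | skip
  all_goals fin_cases j <;> fin_cases j' <;> first | exact absurd rfl hj | skip
  all_goals
    simp only [Had, Matrix.of_apply, Fin.zero_eta, Fin.mk_one, Fin.reduceFinMk, Matrix.cons_val]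
  all_goals grind

theorem HadCond.minor_three_ne_zero {a b c d : F} (h : HadCond a b c d) (i j : Fin 4) :
    ((Had a b c d).submatrix i.succAbove j.succAbove).det ≠ 0 := by
  have hs : a + b + c + d ≠ 0 := h.2.2.2.2.2.2.2.2.2.2.2.2.2
  intro h0
  have hadj : (Had a b c d).adjugate j i = 0 := by
    rw [Matrix.adjugate_fin_succ_eq_det_submatrix, h0, mul_zero]
  have key : (a + b + c + d) ^ 2 • (Had a b c d).adjugate =
      (Had a b c d).det • Had a b c d := by
    calc _ = (Had a b c d).adjugate * (Had a b c d * Had a b c d) := by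
          rw [Had_mul_self, Matrix.mul_smul, Matrix.mul_one]
      _ = _ := by rw [← Matrix.mul_assoc, Matrix.adjugate_mul, Matrix.smul_mul, Matrix.one_mul]
  have hji := congrFun (congrFun key j) i
  simp only [Matrix.smul_apply, hadj, smul_eq_mul, mul_zero] at hji
  exact mul_ne_zero (Had_det_ne_zero hs) (h.apply_ne_zero j i) hji.symm

theorem HadCond.isMDS {a b c d : F} (h : HadCond a b c d) : IsMDS (Had a b c d) := by
  intro k row col hrow hcol
  have hk : k ≤ 4 := by simpa using Fintype.card_le_of_injective row hrow
  interval_cases k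
  · simp
  · simpa using h.apply_ne_zero _ _
  · rw [Matrix.det_fin_two]
    exact h.minor_two_ne_zero (hrow.ne zero_ne_one) (hcol.ne zero_ne_one)
  · obtain ⟨i, e, he, rfl⟩ := Fin.exists_eq_succAbove_comp hrow
    obtain ⟨j, f, hf, rfl⟩ := Fin.exists_eq_succAbove_comp hcol
    exact Matrix.det_submatrix_ne_zero_of_injective (h.minor_three_ne_zero i j) he hf
  · exact Matrix.det_submatrix_ne_zero_of_injective
      (Had_det_ne_zero h.2.2.2.2.2.2.2.2.2.2.2.2.2) hrow hcol

theorem IsMDS.hadCond {a b c d : F} (h : IsMDS (Had a b c d)) : HadCond a b c d := by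
  have entry (j : Fin 4) : Had a b c d 0 j ≠ 0 := by
    have h1 := h 1 (fun _ => 0) (fun _ => j) (Function.injective_of_subsingleton _)
      (Function.injective_of_subsingleton _)
    rwa [Matrix.det_fin_one] at h1
  have minor (i j j' : Fin 4) (hi : 0 ≠ i) (hj : j ≠ j') :
      Had a b c d 0 j * Had a b c d i j' - Had a b c d 0 j' * Had a b c d i j ≠ 0 := by
    have h2 := h 2 ![0, i] ![j, j']
      (by simpa [Function.Injective, Fin.forall_fin_two, eq_comm] using hi)
      (by simpa [Function.Injective, Fin.forall_fin_two, eq_comm] using hj)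
    rwa [Matrix.det_fin_two] at h2
  have hdet : (Had a b c d).det ≠ 0 := h 4 id id Function.injective_id Function.injective_id
  have hs : a + b + c + d ≠ 0 := by
    intro hs
    have h1 := congrArg Matrix.det (Had_mul_self a b c d)
    rw [Matrix.det_mul, hs, Matrix.det_smul] at h1
    exact hdet (by simpa using h1)
  have e0 := entry 0
  have e1 := entry 1
  have e2 := entry 2
  have e3 := entry 3
  have m1 := minor 1 0 1 (by decide) (by decide)
  have m2 := minor 2 0 2 (by decide) (by decide)
  have m3 := minor 3 0 3 (by decide) (by decide)
  have m4 := minor 3 1 2 (by decide) (by decide)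
  have m5 := minor 2 1 3 (by decide) (by decide)
  have m6 := minor 1 2 3 (by decide) (by decide)
  have m7 := minor 1 0 2 (by decide) (by decide)
  have m8 := minor 1 0 3 (by decide) (by decide)
  have m9 := minor 2 0 3 (by decide) (by decide)
  simp only [Had, Matrix.of_apply, Matrix.cons_val] at e0 e1 e2 e3 m1 m2 m3 m4 m5 m6 m7 m8 m9
  clear h entry minor hdet
  refine ⟨e0, e1, e2, e3, ?_, ?_, ?_, ?_, ?_, ?_, ?_, ?_, ?_, hs⟩ <;> grind

theorem isMDS_Had_iff (a b c d : F) : IsMDS (Had a b c d) ↔ HadCond a b c d :=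
  ⟨IsMDS.hadCond, HadCond.isMDS⟩

end Hadamard

section Count

variable {F : Type*} [Field F] [Fintype F]

open Finset Classical

/-- Every MDS Hadamard matrix is determined by the sum of its first row together with the first
row rescaled to start with `1`. -/
theorem card_hadCond_sum_ne_one :
    #{t : F × F × F × F | HadCond t.1 t.2.1 t.2.2.1 t.2.2.2 ∧
        t.1 + t.2.1 + t.2.2.1 + t.2.2.2 ≠ 1} =
      (Fintype.card F - 2) * #{p : F × F × F | HadCond 1 p.1 p.2.1 p.2.2} := by
  have hB : #({0, 1}ᶜ : Finset F) = Fintype.card F - 2 := by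
    rw [card_compl, card_pair zero_ne_one]
  rw [← hB, ← card_product]
  refine card_nbij'
    (fun t => (t.1 + t.2.1 + t.2.2.1 + t.2.2.2, t.2.1 / t.1, t.2.2.1 / t.1, t.2.2.2 / t.1))
    (fun u => let a := u.1 / (1 + u.2.1 + u.2.2.1 + u.2.2.2)
      (a * 1, a * u.2.1, a * u.2.2.1, a * u.2.2.2)) ?_ ?_ ?_ ?_
  · rintro ⟨a, b, c, d⟩ ht
    simp only [coe_filter, mem_univ, true_and, Set.mem_ofPred_eq] at ht
    have ha : a ≠ 0 := ht.1.1
    have hs : a + b + c + d ≠ 0 := ht.1.2.2.2.2.2.2.2.2.2.2.2.2.2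
    have h := (HadCond.smul_iff ha 1 (b / a) (c / a) (d / a)).mp
      (by simpa [mul_div_cancel₀, ha] using ht.1)
    simp [h, hs, ht.2]
  · rintro ⟨s, b, c, d⟩ hu
    simp only [coe_product, coe_filter, Set.mem_prod, mem_coe, mem_compl, mem_insert,
      mem_singleton, not_or, mem_univ, true_and, Set.mem_ofPred_eq] at hu
    obtain ⟨⟨hs0, hs1⟩, h⟩ := hu
    have hs : 1 + b + c + d ≠ 0 := h.2.2.2.2.2.2.2.2.2.2.2.2.2
    simp only [coe_filter, mem_univ, true_and, Set.mem_ofPred_eq]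
    rw [HadCond.smul_iff (div_ne_zero hs0 hs)]
    refine ⟨h, ?_⟩
    rwa [← mul_add, ← mul_add, ← mul_add, div_mul_cancel₀ _ hs]
  · rintro ⟨a, b, c, d⟩ ht
    simp only [coe_filter, mem_univ, true_and, Set.mem_ofPred_eq] at ht
    have ha : a ≠ 0 := ht.1.1
    have hs : a + b + c + d ≠ 0 := ht.1.2.2.2.2.2.2.2.2.2.2.2.2.2
    have h1 : (a + b + c + d) / (1 + b / a + c / a + d / a) = a := by
      rw [show 1 + b / a + c / a + d / a = (a + b + c + d) / a by field_simp, div_div_cancel₀ hs]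
    simp only [h1, mul_one, mul_div_cancel₀ _ ha]
  · rintro ⟨s, b, c, d⟩ hu
    simp only [coe_product, coe_filter, Set.mem_prod, mem_coe, mem_compl, mem_insert,
      mem_singleton, not_or, mem_univ, true_and, Set.mem_ofPred_eq] at hu
    obtain ⟨⟨hs0, hs1⟩, h⟩ := hu
    have hs : 1 + b + c + d ≠ 0 := h.2.2.2.2.2.2.2.2.2.2.2.2.2
    have ha := div_ne_zero hs0 hs
    have hsum : s / (1 + b + c + d) + s / (1 + b + c + d) * b + s / (1 + b + c + d) * c +
        s / (1 + b + c + d) * d = s := by field_simp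
    simp only [mul_one, hsum, mul_div_cancel_left₀ _ ha]

variable [CharP F 2]

/-- The scalars `d` excluded once the first row starts with `1, b, c` are the members of two
quadruples, overlapping in as many points as there are special relations between `b` and `c`. -/
theorem card_filter_hadCond_add {b c : F} (hb0 : b ≠ 0) (hb1 : b ≠ 1) (hc0 : c ≠ 0)
    (hc1 : c ≠ 1) (hbc : b ≠ c) :
    #{d : F | HadCond 1 b c d} + 8 = Fintype.card F +
      ((if c = b⁻¹ then 1 else 0) + (if c ^ 2 = b then 1 else 0) + (if c = b ^ 2 then 1 else 0) +
        (if c = 1 + b then 1 else 0)) := by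
  have h2 : (2 : F) = 0 := CharTwo.two_eq_zero
  set A : Finset F := {0, 1, b, c} with hA
  set B : Finset F := {b * c, b / c, c / b, 1 + b + c} with hB
  have hcompl : ({d : F | HadCond 1 b c d} : Finset F) = (A ∪ B)ᶜ := by
    ext d
    rw [mem_filter_univ]
    simp only [hA, hB, HadCond, mem_compl, mem_union, mem_insert, mem_singleton]
    rw [eq_div_iff hc0, eq_div_iff hb0]
    grind
  have hcA : #A = 4 := by
    rw [hA]
    repeat rw [card_insert_of_notMem]
    all_goals simp; try grind
  have hcB : #B = 4 := by
    rw [hB]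
    repeat rw [card_insert_of_notMem]
    all_goals simp; try grind
  have hinter : #(A ∩ B) = (if c = b⁻¹ then 1 else 0) + (if c ^ 2 = b then 1 else 0) +
      (if c = b ^ 2 then 1 else 0) + (if c = 1 + b then 1 else 0) := by
    have e1 : b * c ∈ A ↔ c = b⁻¹ := by
      simp only [hA, mem_insert, mem_singleton]
      grind
    have e2 : b / c ∈ A ↔ c ^ 2 = b := by
      simp only [hA, mem_insert, mem_singleton]
      grind
    have e3 : c / b ∈ A ↔ c = b ^ 2 := by
      simp only [hA, mem_insert, mem_singleton]
      grind
    have e4 : 1 + b + c ∈ A ↔ c = 1 + b := by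
      simp only [hA, mem_insert, mem_singleton]
      grind
    rw [inter_comm, ← filter_mem_eq_inter, card_filter, hB]
    repeat rw [sum_insert]
    · simp only [sum_singleton, e1, e2, e3, e4]
      ring
    all_goals simp; try grind
  have h3 := card_union_add_card_inter A B
  have h4 := card_compl_add_card (A ∪ B)
  rw [hcompl]
  omega

theorem sum_card_filter_hadCond (hq : 7 ≤ Fintype.card F) {b : F} (hb0 : b ≠ 0) (hb1 : b ≠ 1) :
    ∑ c : F, #{d : F | HadCond 1 b c d} = (Fintype.card F - 4) * (Fintype.card F - 7) := by
  have h2 : (2 : F) = 0 := CharTwo.two_eq_zero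
  obtain ⟨x, rfl⟩ : ∃ x : F, x ^ 2 = b :=
    Finite.surjective_of_injective (CharTwo.sq_injective (R := F)) b
  set b := x ^ 2 with hb
  set C : Finset F := {0, 1, b}ᶜ with hC
  have hCcard : #C + 3 = Fintype.card F := by
    rw [← card_compl_add_card ({0, 1, b} : Finset F), ← hC]
    congr 1
    repeat rw [card_insert_of_notMem]
    all_goals simp; try grind
  have hmem (c : F) : c ∈ C ↔ c ≠ 0 ∧ c ≠ 1 ∧ b ≠ c := by
    simp only [hC, mem_compl, mem_insert, mem_singleton]
    grind
  have hsupp : ∑ c : F, #{d : F | HadCond 1 b c d} = ∑ c ∈ C, #{d : F | HadCond 1 b c d} := by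
    refine (sum_subset (subset_univ C) fun c _ hc => ?_).symm
    rw [card_eq_zero, filter_eq_empty_iff]
    intro d _ h
    refine hc ((hmem c).mpr ?_)
    unfold HadCond at h
    grind
  have hsum : ∑ c ∈ C, (#{d : F | HadCond 1 b c d} + 8) = ∑ c ∈ C, (Fintype.card F +
      ((if c = b⁻¹ then 1 else 0) + (if c = x then 1 else 0) + (if c = b ^ 2 then 1 else 0) +
        (if c = 1 + b then 1 else 0))) := by
    refine sum_congr rfl fun c hc => ?_
    obtain ⟨hc0, hc1, hbc⟩ := (hmem c).mp hc
    rw [card_filter_hadCond_add hb0 hb1 hc0 hc1 hbc]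
    simp only [hb, (CharTwo.sq_injective (R := F)).eq_iff]
  have m1 : b⁻¹ ∈ C := by rw [hmem]; grind
  have m2 : x ∈ C := by rw [hmem]; grind
  have m3 : b ^ 2 ∈ C := by rw [hmem]; grind
  have m4 : 1 + b ∈ C := by rw [hmem]; grind
  simp only [sum_add_distrib, sum_const, smul_eq_mul, sum_ite_eq', m1, m2, m3, m4, if_true] at hsum
  rw [hsupp]
  obtain ⟨n, hn⟩ := Nat.exists_eq_add_of_le hq
  have hCn : #C = n + 4 := by omega
  rw [hCn, hn] at hsum
  rw [hn, show 7 + n - 4 = n + 3 by omega, show 7 + n - 7 = n by omega]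
  linarith

/-- The number of MDS Hadamard matrices whose first row starts with `1`. -/
theorem card_hadCond_one (hq : 7 ≤ Fintype.card F) :
    #{p : F × F × F | HadCond 1 p.1 p.2.1 p.2.2} =
      (Fintype.card F - 2) * ((Fintype.card F - 4) * (Fintype.card F - 7)) := by
  have hB : #({0, 1}ᶜ : Finset F) = Fintype.card F - 2 := by
    rw [card_compl, card_pair zero_ne_one]
  rw [card_filter, Fintype.sum_prod_type]
  simp_rw [Fintype.sum_prod_type, ← card_filter]
  rw [← sum_subset (subset_univ ({0, 1}ᶜ : Finset F)), ← hB, ← smul_eq_mul, ← sum_const]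
  · refine sum_congr rfl fun b hb => ?_
    simp only [mem_compl, mem_insert, mem_singleton, not_or] at hb
    exact sum_card_filter_hadCond hq hb.1 hb.2
  · refine fun b _ hb => sum_eq_zero fun c _ => ?_
    rw [card_eq_zero, filter_eq_empty_iff]
    intro d _ h
    refine hb ?_
    simp only [mem_compl, mem_insert, mem_singleton, not_or]
    exact ⟨h.2.1, h.2.2.2.2.1.symm⟩

end Count

/-- The number of tuples `(a,b,c,d) ∈ 𝔽_{2^r}^4` (with `r ≥ 3`) whose `4 × 4`
Hadamard matrix is MDS but not involutory equals `(2^r-2)²(2^r-4)(2^r-7)`. -/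
theorem count_non_involutory_hadamard_mds (r : ℕ) (hr : 3 ≤ r) :
    Nat.card {t : GaloisField 2 r × GaloisField 2 r × GaloisField 2 r × GaloisField 2 r //
        IsMDS (Had t.1 t.2.1 t.2.2.1 t.2.2.2) ∧
        ¬ (Had t.1 t.2.1 t.2.2.1 t.2.2.2 * Had t.1 t.2.1 t.2.2.1 t.2.2.2 = 1)} =
      (2 ^ r - 2) ^ 2 * (2 ^ r - 4) * (2 ^ r - 7) := by
  classical
  let _ : Fintype (GaloisField 2 r) := Fintype.ofFinite _
  have hcard : Fintype.card (GaloisField 2 r) = 2 ^ r := by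
    rw [← Nat.card_eq_fintype_card, GaloisField.card 2 r (by omega)]
  have hq : 7 ≤ Fintype.card (GaloisField 2 r) := by
    rw [hcard]
    exact le_trans (by norm_num) (Nat.pow_le_pow_right two_pos hr)
  simp only [isMDS_Had_iff, Had_mul_self_eq_one_iff]
  rw [Nat.card_eq_fintype_card, Fintype.card_subtype, ← hcard]
  convert card_hadCond_sum_ne_one (F := GaloisField 2 r) using 1
  rw [card_hadCond_one hq]
  ring
end

section
/- Let r ≥ 1 and let 𝔽 = 𝔽_{2^r}. The number of tuples (a1, a2, a3, a4) ∈ 𝔽^4 such that exactly one of a1, a2, a3, a4 equals 0 and the 4×4 Hadamard matrix Had(a1, a2, a3, a4) is both involutory and NMDS (equivalently, NMDS with a1 + a2 + a3 + a4 = 1) equals 4·(2^{2r} − 3·2^r + 3). -/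
open Matrix

/-- A square matrix of order `n` is Near-MDS if it is not MDS and, for every
`1 ≤ g ≤ n - 1`, every `g × (g+1)` and `(g+1) × g` submatrix contains a
nonsingular `g × g` submatrix. -/
def IsNMDS {F : Type*} [Field F] {ι : Type*} [Fintype ι] (M : Matrix ι ι F) : Prop :=
  ¬ IsMDS M ∧
  ∀ g : ℕ, 1 ≤ g → g ≤ Fintype.card ι - 1 →
    (∀ (row : Fin g → ι) (col : Fin (g + 1) → ι),
        Function.Injective row → Function.Injective col →
        ∃ s : Fin g → Fin (g + 1), Function.Injective s ∧
          (M.submatrix row (col ∘ s)).det ≠ 0) ∧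
    (∀ (row : Fin (g + 1) → ι) (col : Fin g → ι),
        Function.Injective row → Function.Injective col →
        ∃ s : Fin g → Fin (g + 1), Function.Injective s ∧
          (M.submatrix (row ∘ s) col).det ≠ 0)

/-- Exactly one of the four elements equals zero. -/
def ExactlyOneZero {F : Type*} [Zero F] (a b c d : F) : Prop :=
  (a = 0 ∧ b ≠ 0 ∧ c ≠ 0 ∧ d ≠ 0) ∨ (a ≠ 0 ∧ b = 0 ∧ c ≠ 0 ∧ d ≠ 0) ∨
  (a ≠ 0 ∧ b ≠ 0 ∧ c = 0 ∧ d ≠ 0) ∨ (a ≠ 0 ∧ b ≠ 0 ∧ c ≠ 0 ∧ d = 0)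

/-- Deleting a row of a nonsingular matrix leaves a matrix with a nonvanishing maximal minor. -/
theorem exists_submatrix_det_ne_zero {F : Type*} [Field F] {n : ℕ}
    {M : Matrix (Fin (n + 1)) (Fin (n + 1)) F} (hM : M.det ≠ 0)
    {row : Fin n → Fin (n + 1)} {col : Fin (n + 1) → Fin (n + 1)}
    (hrow : Function.Injective row) (hcol : Function.Injective col) :
    ∃ s : Fin n → Fin (n + 1), Function.Injective s ∧ (M.submatrix row (col ∘ s)).det ≠ 0 := by
  obtain ⟨x, hx⟩ : ∃ x, x ∉ Set.range row := by
    by_contra! h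
    have := Fintype.card_le_of_surjective row h
    simp at this
  let σ := Equiv.ofBijective (Fin.cons x row : Fin (n + 1) → Fin (n + 1))
    (Finite.injective_iff_bijective.mp (Fin.cons_injective_iff.mpr ⟨hx, hrow⟩))
  let τ := Equiv.ofBijective col (Finite.injective_iff_bijective.mp hcol)
  have hN : (M.submatrix σ τ).det ≠ 0 := by
    rw [show M.submatrix σ τ = (M.submatrix σ id).submatrix id τ from rfl, det_permute',
      det_permute]
    rcases Int.units_eq_one_or (Equiv.Perm.sign σ) with h | h <;>
      rcases Int.units_eq_one_or (Equiv.Perm.sign τ) with h' | h' <;> simpa [h, h'] using hM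
  rw [det_succ_row_zero] at hN
  obtain ⟨j, -, hj⟩ := Finset.exists_ne_zero_of_sum_ne_zero hN
  exact ⟨j.succAbove, Fin.succAbove_right_injective, right_ne_zero_of_mul hj⟩

/-- In a `4 × 4` matrix whose zeros form a permutation pattern, every `2 × 3` submatrix
has a nonvanishing `2 × 2` minor. -/
theorem exists_two_submatrix_det_ne_zero {F : Type*} [Field F] {M : Matrix (Fin 4) (Fin 4) F}
    {π : Fin 4 → Fin 4} (hπ : Function.Injective π) (hM : ∀ i j, M i j = 0 ↔ j = π i)
    {row : Fin 2 → Fin 4} {col : Fin 3 → Fin 4}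
    (hrow : Function.Injective row) (hcol : Function.Injective col) :
    ∃ s : Fin 2 → Fin 3, Function.Injective s ∧ (M.submatrix row (col ∘ s)).det ≠ 0 := by
  have hne : π (row 0) ≠ π (row 1) := fun h => by simpa using hrow (hπ h)
  obtain ⟨k, hk⟩ : ∃ k, col k = π (row 0) ∨ col k = π (row 1) := by
    by_contra! h
    have h01 : col 0 ≠ col 1 := hcol.ne (by decide)
    have h02 : col 0 ≠ col 2 := hcol.ne (by decide)
    have h12 : col 1 ≠ col 2 := hcol.ne (by decide)
    have h0 := h 0
    have h1 := h 1
    have h2 := h 2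
    omega
  have hkl : k ≠ k + 1 := by fin_cases k <;> decide
  refine ⟨![k, k + 1], ?_, ?_⟩
  · intro i j
    fin_cases i <;> fin_cases j <;> simp [hkl, hkl.symm]
  · have hcol' : col (k + 1) ≠ col k := hcol.ne hkl.symm
    rw [det_fin_two]
    rcases hk with hk | hk
    · have h0 : M (row 0) (col k) = 0 := (hM _ _).mpr hk
      have h1 : M (row 0) (col (k + 1)) ≠ 0 := by rwa [ne_eq, hM, ← hk]
      have h2 : M (row 1) (col k) ≠ 0 := by rwa [ne_eq, hM, hk]
      simp [h0, h1, h2]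
    · have h0 : M (row 1) (col k) = 0 := (hM _ _).mpr hk
      have h1 : M (row 1) (col (k + 1)) ≠ 0 := by rwa [ne_eq, hM, ← hk]
      have h2 : M (row 0) (col k) ≠ 0 := by rw [ne_eq, hM, hk]; exact hne.symm
      simp [h0, h1, h2]

/-- A nonsingular symmetric `4 × 4` matrix whose zeros form a permutation pattern is NMDS. -/
theorem isNMDS_of_eq_zero_iff {F : Type*} [Field F] {M : Matrix (Fin 4) (Fin 4) F}
    {π : Fin 4 → Fin 4} (hπ : Function.Injective π) (hM : ∀ i j, M i j = 0 ↔ j = π i)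
    (hsymm : Mᵀ = M) (hdet : M.det ≠ 0) : IsNMDS M := by
  have key : ∀ g : ℕ, 1 ≤ g → g ≤ 3 → ∀ (row : Fin g → Fin 4) (col : Fin (g + 1) → Fin 4),
      Function.Injective row → Function.Injective col →
      ∃ s : Fin g → Fin (g + 1), Function.Injective s ∧
        (M.submatrix row (col ∘ s)).det ≠ 0 := by
    intro g hg hg' row col hrow hcol
    interval_cases g
    · obtain ⟨k, hk⟩ : ∃ k, col k ≠ π (row 0) := by
        by_contra! h
        exact hcol.ne (by decide : (0 : Fin 2) ≠ 1) ((h 0).trans (h 1).symm)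
      exact ⟨fun _ => k, Function.injective_of_subsingleton _, by
        simpa [det_fin_one, hM] using hk⟩
    · exact exists_two_submatrix_det_ne_zero hπ hM hrow hcol
    · exact exists_submatrix_det_ne_zero hdet hrow hcol
  refine ⟨fun h => h 1 (fun _ => 0) (fun _ => π 0) (Function.injective_of_subsingleton _)
    (Function.injective_of_subsingleton _) (by simp [hM]), fun g hg hg' =>
    ⟨key g hg (by simpa using hg'), fun row col hrow hcol => ?_⟩⟩
  obtain ⟨s, hs, h⟩ := key g hg (by simpa using hg') col row hcol hrow
  refine ⟨s, hs, ?_⟩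
  rwa [← det_transpose, transpose_submatrix, hsymm]

theorem had_transpose {F : Type*} (a b c d : F) : (Had a b c d)ᵀ = Had a b c d := by
  ext i j
  fin_cases i <;> fin_cases j <;> rfl

theorem had_mul_self_eq_one_iff {F : Type*} [Field F] [CharP F 2] (a b c d : F) :
    Had a b c d * Had a b c d = 1 ↔ a + b + c + d = 1 := by
  have h2 : (2 : F) = 0 := CharTwo.two_eq_zero
  have hsq : Had a b c d * Had a b c d = ((a + b + c + d) ^ 2) • (1 : Matrix _ _ F) := by
    ext i j
    fin_cases i <;> fin_cases j <;> simp [Had, mul_apply, Fin.sum_univ_four] <;> grind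
  rw [hsq]
  constructor
  · intro h
    have h00 := congrFun (congrFun h 0) 0
    simp only [Matrix.smul_apply, one_apply_eq, smul_eq_mul, mul_one] at h00
    rw [← sub_eq_zero] at h00 ⊢
    exact pow_eq_zero_iff two_ne_zero |>.mp (by grind)
  · intro h
    simp [h]

theorem isNMDS_had {F : Type*} [Field F] {a b c d : F} (h : ExactlyOneZero a b c d)
    (hinv : Had a b c d * Had a b c d = 1) : IsNMDS (Had a b c d) := by
  have hdet : (Had a b c d).det ≠ 0 := fun h0 => by
    simpa [h0] using congrArg det hinv
  have hsymm := had_transpose a b c d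
  rcases h with ⟨ha, hb, hc, hd⟩ | ⟨ha, hb, hc, hd⟩ | ⟨ha, hb, hc, hd⟩ | ⟨ha, hb, hc, hd⟩
  · refine isNMDS_of_eq_zero_iff (π := ![0, 1, 2, 3]) (by decide) (fun i j => ?_) hsymm hdet
    fin_cases i <;> fin_cases j <;> simp [Had, ha, hb, hc, hd]
  · refine isNMDS_of_eq_zero_iff (π := ![1, 0, 3, 2]) (by decide) (fun i j => ?_) hsymm hdet
    fin_cases i <;> fin_cases j <;> simp [Had, ha, hb, hc, hd]
  · refine isNMDS_of_eq_zero_iff (π := ![2, 3, 0, 1]) (by decide) (fun i j => ?_) hsymm hdet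
    fin_cases i <;> fin_cases j <;> simp [Had, ha, hb, hc, hd]
  · refine isNMDS_of_eq_zero_iff (π := ![3, 2, 1, 0]) (by decide) (fun i j => ?_) hsymm hdet
    fin_cases i <;> fin_cases j <;> simp [Had, ha, hb, hc, hd]

open Classical in
/-- The number of pairs of nonzero elements of a finite field whose sum is not `1`. -/
theorem card_nonzero_pairs_add_ne_one (F : Type*) [Field F] [Fintype F] :
    ((Finset.univ.filter fun p : F × F => p.1 ≠ 0 ∧ p.2 ≠ 0 ∧ p.1 + p.2 ≠ 1).card : ℤ) =
      Fintype.card F ^ 2 - 3 * Fintype.card F + 3 := by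
  rw [Finset.card_filter]
  push_cast
  rw [Fintype.sum_prod_type]
  have h : ∀ a b : F, (if a ≠ 0 ∧ b ≠ 0 ∧ a + b ≠ 1 then (1 : ℤ) else 0) =
      1 - (if a = 0 then 1 else 0) - (if b = 0 then 1 else 0) - (if b = 1 - a then 1 else 0)
      + (if a = 0 then (if b = 0 then 1 else 0) else 0)
      + (if a = 0 then (if b = 1 then 1 else 0) else 0)
      + (if a = 1 then (if b = 0 then 1 else 0) else 0) := by
    intro a b
    have h01 : (0 : F) ≠ 1 := zero_ne_one
    grind
  simp only [h, Finset.sum_add_distrib, Finset.sum_sub_distrib]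
  simp
  ring

open Classical in
theorem card_exactlyOneZero_sum_eq_one (F : Type*) [Field F] [Fintype F] :
    ((Finset.univ.filter fun t : F × F × F × F =>
      ExactlyOneZero t.1 t.2.1 t.2.2.1 t.2.2.2 ∧ t.1 + t.2.1 + t.2.2.1 + t.2.2.2 = 1).card : ℤ) =
      4 * (Fintype.card F ^ 2 - 3 * Fintype.card F + 3) := by
  set N := Finset.univ.filter fun p : F × F => p.1 ≠ 0 ∧ p.2 ≠ 0 ∧ p.1 + p.2 ≠ 1 with hN
  have hcard : (Finset.univ.filter fun t : F × F × F × F =>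
      ExactlyOneZero t.1 t.2.1 t.2.2.1 t.2.2.2 ∧ t.1 + t.2.1 + t.2.2.1 + t.2.2.2 = 1).card =
      ((Finset.univ : Finset (Fin 4)) ×ˢ N).card := by
    symm
    refine Finset.card_bij (fun x _ =>
      ![(0, x.2.1, x.2.2, 1 - (x.2.1 + x.2.2)), (x.2.1, 0, x.2.2, 1 - (x.2.1 + x.2.2)),
        (x.2.1, x.2.2, 0, 1 - (x.2.1 + x.2.2)), (x.2.1, x.2.2, 1 - (x.2.1 + x.2.2), 0)] x.1)
      ?_ ?_ ?_
    · rintro ⟨i, a, b⟩ hx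
      simp only [hN, Finset.mem_product, Finset.mem_univ, true_and, Finset.mem_filter] at hx
      fin_cases i <;> simp [ExactlyOneZero] <;> grind
    · rintro ⟨i, a, b⟩ hx ⟨j, a', b'⟩ hy h
      simp only [hN, Finset.mem_product, Finset.mem_univ, true_and, Finset.mem_filter] at hx hy
      fin_cases i <;> fin_cases j <;> simp at h ⊢ <;> grind
    · rintro ⟨a, b, c, d⟩ ht
      simp only [Finset.mem_univ, true_and, Finset.mem_filter] at ht
      obtain ⟨h | h | h | h, hs⟩ := ht
      · exact ⟨(0, b, c), by simp [hN]; grind, by simp; grind⟩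
      · exact ⟨(1, a, c), by simp [hN]; grind, by simp; grind⟩
      · exact ⟨(2, a, b), by simp [hN]; grind, by simp; grind⟩
      · exact ⟨(3, a, b), by simp [hN]; grind, by simp; grind⟩
  rw [hcard, Finset.card_product]
  push_cast
  rw [hN, card_nonzero_pairs_add_ne_one]
  simp

/-- The number of tuples `(a₁,a₂,a₃,a₄) ∈ 𝔽_{2^r}^4` with exactly one `aᵢ = 0`
whose `4 × 4` Hadamard matrix is involutory and NMDS equals
`4(2^{2r} - 3·2^r + 3)`. -/
theorem count_involutory_hadamard_nmds_one_zero (r : ℕ) (hr : 1 ≤ r) :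
    (Nat.card {t : GaloisField 2 r × GaloisField 2 r × GaloisField 2 r × GaloisField 2 r //
        ExactlyOneZero t.1 t.2.1 t.2.2.1 t.2.2.2 ∧
        Had t.1 t.2.1 t.2.2.1 t.2.2.2 * Had t.1 t.2.1 t.2.2.1 t.2.2.2 = 1 ∧
        IsNMDS (Had t.1 t.2.1 t.2.2.1 t.2.2.2)} : ℤ) =
      4 * (2 ^ (2 * r) - 3 * 2 ^ r + 3) := by
  classical
  have := Fintype.ofFinite (GaloisField 2 r)
  have hq : Fintype.card (GaloisField 2 r) = 2 ^ r := by
    rw [← Nat.card_eq_fintype_card]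
    exact GaloisField.card 2 r (by omega)
  have hiff : ∀ t : GaloisField 2 r × GaloisField 2 r × GaloisField 2 r × GaloisField 2 r,
      (ExactlyOneZero t.1 t.2.1 t.2.2.1 t.2.2.2 ∧
        Had t.1 t.2.1 t.2.2.1 t.2.2.2 * Had t.1 t.2.1 t.2.2.1 t.2.2.2 = 1 ∧
        IsNMDS (Had t.1 t.2.1 t.2.2.1 t.2.2.2)) ↔
      ExactlyOneZero t.1 t.2.1 t.2.2.1 t.2.2.2 ∧ t.1 + t.2.1 + t.2.2.1 + t.2.2.2 = 1 :=
    fun t => ⟨fun ⟨h, hinv, _⟩ => ⟨h, (had_mul_self_eq_one_iff _ _ _ _).mp hinv⟩,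
      fun ⟨h, hs⟩ =>
        have hinv := (had_mul_self_eq_one_iff _ _ _ _).mpr hs
        ⟨h, hinv, isNMDS_had h hinv⟩⟩
  simp_rw [hiff]
  rw [Nat.card_eq_fintype_card, Fintype.card_subtype, card_exactlyOneZero_sum_eq_one, hq]
  push_cast
  ring
end

section
/- Let r ≥ 1 and let 𝔽 = 𝔽_{2^r}. The number of tuples (a1, a2, a3, a4) ∈ 𝔽^4 such that exactly one of a1, a2, a3, a4 equals 0 and the 4×4 circulant matrix Circ(a1, a2, a3, a4) is NMDS equals 4·(2^r−1)³. -/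
open Matrix

/-- The `4 × 4` circulant matrix with first row `a, b, c, d`. -/
def Circ {F : Type*} (a b c d : F) : Matrix (Fin 4) (Fin 4) F :=
  !![a, b, c, d; d, a, b, c; c, d, a, b; b, c, d, a]

lemma circ_apply {F : Type*} (a b c d : F) (i j : Fin 4) : Circ a b c d i j = ![a, b, c, d] (j - i) := by
  fin_cases i <;> fin_cases j <;> rfl

lemma circ_transpose {F : Type*} (a b c d : F) : (Circ a b c d)ᵀ = Circ a d c b := by
  ext i j
  fin_cases i <;> fin_cases j <;> rfl

lemma circ_rotate {F : Type*} (a b c d : F) :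
    Circ b c d a = (Circ a b c d).submatrix id (Equiv.addRight (1 : Fin 4)) := by
  ext i j
  fin_cases i <;> fin_cases j <;> rfl

section Minors

variable {F : Type*} [Field F]

lemma IsMDS.of_submatrix_col {ι : Type*} {M : Matrix ι ι F} (e : ι ≃ ι)
    (h : IsMDS (M.submatrix id e)) : IsMDS M := by
  intro k row col hrow hcol
  simpa [Function.comp_def] using
    h k row (e.symm ∘ col) hrow (e.symm.injective.comp hcol)

lemma IsNMDS.submatrix_col {ι : Type*} [Fintype ι] {M : Matrix ι ι F} (e : ι ≃ ι)
    (h : IsNMDS M) : IsNMDS (M.submatrix id e) :=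
  ⟨fun hM => h.1 (hM.of_submatrix_col e), fun g h1 hg =>
    ⟨fun row col hrow hcol => (h.2 g h1 hg).1 row (e ∘ col) hrow (e.injective.comp hcol),
     fun row col hrow hcol => (h.2 g h1 hg).2 row (e ∘ col) hrow (e.injective.comp hcol)⟩⟩

lemma not_isMDS_of_apply_eq_zero {ι : Type*} {M : Matrix ι ι F} {i j : ι} (h : M i j = 0) :
    ¬ IsMDS M := fun hM =>
  hM 1 ![i] ![j] (Function.injective_of_subsingleton _) (Function.injective_of_subsingleton _)
    ((det_fin_one _).trans h)

/-- It suffices to find a nonzero minor whose columns lie in the range of `col`. -/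
lemma exists_minor_of_range {ι : Type*} {M : Matrix ι ι F} {g : ℕ} {row : Fin g → ι}
    {col : Fin (g + 1) → ι} (t : Fin g → ι) (ht : Function.Injective t)
    (hmem : ∀ i, ∃ j, col j = t i) (hdet : (M.submatrix row t).det ≠ 0) :
    ∃ s : Fin g → Fin (g + 1), Function.Injective s ∧
      (M.submatrix row (col ∘ s)).det ≠ 0 := by
  choose s hs using hmem
  have hst : col ∘ s = t := funext hs
  exact ⟨s, Function.Injective.of_comp (f := col) (hst ▸ ht), hst ▸ hdet⟩

lemma circ_apply_self (b c d : F) (i : Fin 4) : Circ 0 b c d i i = 0 := by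
  simp [circ_apply]

lemma circ_apply_ne {b c d : F} (hb : b ≠ 0) (hc : c ≠ 0) (hd : d ≠ 0) {i j : Fin 4}
    (h : i ≠ j) : Circ 0 b c d i j ≠ 0 := by
  revert h
  fin_cases i <;> fin_cases j <;> simp [Circ, hb, hc, hd]

lemma exists_one_minor {b c d : F} (hb : b ≠ 0) (hc : c ≠ 0) (hd : d ≠ 0)
    (row : Fin 1 → Fin 4) (col : Fin 2 → Fin 4) (hcol : Function.Injective col) :
    ∃ s : Fin 1 → Fin 2, Function.Injective s ∧
      ((Circ 0 b c d).submatrix row (col ∘ s)).det ≠ 0 := by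
  obtain ⟨j, hj⟩ : ∃ j, row 0 ≠ col j := by
    by_contra! h
    exact absurd (hcol ((h 0).symm.trans (h 1))) (by decide)
  exact ⟨fun _ => j, Function.injective_of_subsingleton _,
    by simpa using circ_apply_ne hb hc hd hj⟩

lemma exists_omitted : ∀ col : Fin 3 → Fin 4, Function.Injective col →
    ∃ k, ∀ p, p ≠ k → ∃ j, col j = p := by
  decide

lemma exists_two_minor {b c d : F} (hb : b ≠ 0) (hc : c ≠ 0) (hd : d ≠ 0)
    (row : Fin 2 → Fin 4) (col : Fin 3 → Fin 4) (hrow : Function.Injective row)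
    (hcol : Function.Injective col) :
    ∃ s : Fin 2 → Fin 3, Function.Injective s ∧
      ((Circ 0 b c d).submatrix row (col ∘ s)).det ≠ 0 := by
  obtain ⟨k, hk⟩ := exists_omitted col hcol
  have hij : row 0 ≠ row 1 := fun h => absurd (hrow h) (by decide)
  suffices h : ∃ p q, p ≠ q ∧ p ≠ k ∧ q ≠ k ∧
      ((Circ 0 b c d).submatrix row ![p, q]).det ≠ 0 by
    obtain ⟨p, q, hpq, hp, hq, hdet⟩ := h
    refine exists_minor_of_range ![p, q] ?_ ?_ hdet
    · simpa [Function.Injective, Fin.forall_fin_two, eq_comm] using hpq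
    · simpa [Fin.forall_fin_two] using ⟨hk p hp, hk q hq⟩
  have hne : ∀ {i j}, i ≠ j → Circ 0 b c d i j ≠ 0 := circ_apply_ne hb hc hd
  obtain ⟨l, hli, hlj⟩ : ∃ l, row 0 ≠ l ∧ row 1 ≠ l :=
    (by decide : ∀ i j : Fin 4, ∃ l, i ≠ l ∧ j ≠ l) _ _
  by_cases hik : row 0 = k
  · refine ⟨row 1, l, hlj, hik ▸ hij.symm, hik ▸ hli.symm, ?_⟩
    simp [det_fin_two, circ_apply_self, hne hij, hne hlj]
  by_cases hjk : row 1 = k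
  · refine ⟨row 0, l, hli, hik, hjk ▸ hlj.symm, ?_⟩
    simp [det_fin_two, circ_apply_self, hne hij.symm, hne hli]
  · refine ⟨row 0, row 1, hij, hik, hjk, ?_⟩
    simp [det_fin_two, circ_apply_self, hne hij, hne hij.symm]

lemma exists_rotate_perm : ∀ row : Fin 3 → Fin 4, Function.Injective row →
    ∃ m, ∃ σ : Equiv.Perm (Fin 3), ∀ i, row i = ![0, 1, 2] (σ i) + m := by
  decide

lemma exists_three_minor [CharP F 2] {b c d : F} (hb : b ≠ 0) (hc : c ≠ 0)
    (row : Fin 3 → Fin 4) (col : Fin 4 → Fin 4) (hrow : Function.Injective row)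
    (hcol : Function.Injective col) :
    ∃ s : Fin 3 → Fin 4, Function.Injective s ∧
      ((Circ 0 b c d).submatrix row (col ∘ s)).det ≠ 0 := by
  obtain ⟨m, σ, hσ⟩ := exists_rotate_perm row hrow
  have h2 : (2 : F) = 0 := CharTwo.two_eq_zero
  have hdet : ∀ t : Fin 3 → Fin 4,
      ((Circ 0 b c d).submatrix row (fun i => t i + m)).det =
        Equiv.Perm.sign σ * ((Circ 0 b c d).submatrix ![0, 1, 2] t).det := fun t => by
    rw [← det_permute]
    congr 1
    ext i j
    simp only [submatrix_apply, id, hσ, circ_apply, add_sub_add_right_eq_sub]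
  have key : ∃ t : Fin 3 → Fin 4, Function.Injective t ∧
      ((Circ 0 b c d).submatrix ![0, 1, 2] t).det ≠ 0 := by
    by_cases hbd : b = d
    · subst hbd
      refine ⟨![1, 2, 3], by decide, ?_⟩
      have : ((Circ 0 b c b).submatrix ![0, 1, 2] ![1, 2, 3]).det = b * c ^ 2 := by
        rw [det_fin_three]
        simp [Circ]
        ring
      rw [this]
      simp [hb, hc]
    · refine ⟨![0, 1, 2], by decide, ?_⟩
      have : ((Circ 0 b c d).submatrix ![0, 1, 2] ![0, 1, 2]).det = c * (b - d) ^ 2 := by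
        rw [det_fin_three]
        simp [Circ]
        linear_combination b * c * d * h2
      rw [this]
      simp [hc, sub_ne_zero.mpr hbd]
  obtain ⟨t, ht, htdet⟩ := key
  refine exists_minor_of_range (fun i => t i + m) ((add_left_injective m).comp ht)
    (fun i => (Finite.injective_iff_surjective.mp hcol) _) ?_
  rw [hdet]
  rcases Int.units_eq_one_or (Equiv.Perm.sign σ) with h | h <;> simpa [h] using htdet

lemma exists_minor [CharP F 2] {b c d : F} (hb : b ≠ 0) (hc : c ≠ 0) (hd : d ≠ 0)
    {g : ℕ} (h1 : 1 ≤ g) (hg : g ≤ 3) (row : Fin g → Fin 4) (col : Fin (g + 1) → Fin 4)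
    (hrow : Function.Injective row) (hcol : Function.Injective col) :
    ∃ s : Fin g → Fin (g + 1), Function.Injective s ∧
      ((Circ 0 b c d).submatrix row (col ∘ s)).det ≠ 0 := by
  interval_cases g
  · exact exists_one_minor hb hc hd row col hcol
  · exact exists_two_minor hb hc hd row col hrow hcol
  · exact exists_three_minor hb hc row col hrow hcol

lemma isNMDS_circ_zero [CharP F 2] {b c d : F} (hb : b ≠ 0) (hc : c ≠ 0) (hd : d ≠ 0) :
    IsNMDS (Circ 0 b c d) := by
  refine ⟨not_isMDS_of_apply_eq_zero (circ_apply_self b c d 0), fun g h1 hg =>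
    ⟨exists_minor hb hc hd h1 hg, fun row col hrow hcol => ?_⟩⟩
  obtain ⟨s, hs, hdet⟩ := exists_minor hd hc hb h1 hg col row hcol hrow
  refine ⟨s, hs, ?_⟩
  rwa [← det_transpose, transpose_submatrix, circ_transpose]

lemma ExactlyOneZero.isNMDS_circ [CharP F 2] {a b c d : F} (h : ExactlyOneZero a b c d) :
    IsNMDS (Circ a b c d) := by
  rcases h with ⟨rfl, hb, hc, hd⟩ | ⟨ha, rfl, hc, hd⟩ | ⟨ha, hb, rfl, hd⟩ | ⟨ha, hb, hc, rfl⟩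
  · exact isNMDS_circ_zero hb hc hd
  · simpa only [← circ_rotate] using
      (((isNMDS_circ_zero hc hd ha).submatrix_col (Equiv.addRight 1)).submatrix_col
        (Equiv.addRight 1)).submatrix_col (Equiv.addRight 1)
  · simpa only [← circ_rotate] using
      ((isNMDS_circ_zero hd ha hb).submatrix_col (Equiv.addRight 1)).submatrix_col
        (Equiv.addRight 1)
  · simpa only [← circ_rotate] using
      (isNMDS_circ_zero ha hb hc).submatrix_col (Equiv.addRight 1)

end Minors

lemma card_exactlyOneZero (F : Type*) [Zero F] [Fintype F] [DecidableEq F] :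
    Nat.card {t : F × F × F × F // ExactlyOneZero t.1 t.2.1 t.2.2.1 t.2.2.2} =
      4 * (Fintype.card F - 1) ^ 3 := by
  let Z : Finset F := {0}
  let U : Finset F := {0}ᶜ
  have hU : U.card = Fintype.card F - 1 := by simp [U, Finset.card_compl]
  have hZU : Disjoint Z U := disjoint_compl_right
  rw [Nat.subtype_card (((Z ×ˢ U ×ˢ U ×ˢ U).disjUnion (U ×ˢ Z ×ˢ U ×ˢ U)
      (by simp [Finset.disjoint_product, hZU])).disjUnion
      ((U ×ˢ U ×ˢ Z ×ˢ U).disjUnion (U ×ˢ U ×ˢ U ×ˢ Z)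
      (by simp [Finset.disjoint_product, hZU]))
      (by simp [Finset.disjoint_product, hZU]))
      (by simp [ExactlyOneZero, Z, U]; grind)]
  simp only [Finset.card_disjUnion, Finset.card_product, hU, Z, Finset.card_singleton]
  ring

/-- The number of tuples `(a₁,a₂,a₃,a₄) ∈ 𝔽_{2^r}^4` with exactly one `aᵢ = 0`
whose `4 × 4` circulant matrix is NMDS equals `4(2^r-1)³`. -/
theorem count_circulant_nmds_one_zero (r : ℕ) (hr : 1 ≤ r) :
    Nat.card {t : GaloisField 2 r × GaloisField 2 r × GaloisField 2 r × GaloisField 2 r //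
        ExactlyOneZero t.1 t.2.1 t.2.2.1 t.2.2.2 ∧
        IsNMDS (Circ t.1 t.2.1 t.2.2.1 t.2.2.2)} =
      4 * (2 ^ r - 1) ^ 3 := by
  classical
  have : Fintype (GaloisField 2 r) := Fintype.ofFinite _
  have hcard : Fintype.card (GaloisField 2 r) = 2 ^ r := by
    rw [← Nat.card_eq_fintype_card, GaloisField.card 2 r (by omega)]
  rw [← hcard, ← card_exactlyOneZero]
  exact Nat.card_congr (Equiv.subtypeEquivRight fun _ =>
    ⟨And.left, fun h => ⟨h, h.isNMDS_circ⟩⟩)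
end
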